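/- arXiv:2312.04825 — 5 statements merged into one kernel-verified Lean document; each statement's English description precedes it below -/
import Mathlib

section
/- Let C_{n+1}, C_n, C_{n−1} be finite-dimensional real inner product spaces and let B_n : C_n → C_{n−1} and B_{n+1} : C_{n+1} → C_n be linear maps satisfying the chain condition B_n ∘ B_{n+1} = 0. Then ker(B_n* ∘ B_n + B_{n+1} ∘ B_{n+1}*) = ker(B_n) ∩ (range(B_{n+1}))^⊥, where ⊥ denotes the orthogonal complement in C_n. -/
/-- Key identity in the proof of the Discrete Hodge Theorem (Theorem 4.3):
under the chain condition `Bₙ ∘ Bₙ₊₁ = 0`,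
`ker (Bₙ* ∘ Bₙ + Bₙ₊₁ ∘ Bₙ₊₁*) = ker Bₙ ⊓ (range Bₙ₊₁)ᗮ`. -/
theorem ker_laplacian_eq_ker_inf_orthogonal
    {Cp Cn Cm : Type*}
    [NormedAddCommGroup Cp] [InnerProductSpace ℝ Cp] [FiniteDimensional ℝ Cp]
    [NormedAddCommGroup Cn] [InnerProductSpace ℝ Cn] [FiniteDimensional ℝ Cn]
    [NormedAddCommGroup Cm] [InnerProductSpace ℝ Cm] [FiniteDimensional ℝ Cm]
    (Bn : Cn →ₗ[ℝ] Cm) (Bn1 : Cp →ₗ[ℝ] Cn)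
    (hchain : Bn ∘ₗ Bn1 = 0) :
    LinearMap.ker (LinearMap.adjoint Bn ∘ₗ Bn + Bn1 ∘ₗ LinearMap.adjoint Bn1) =
      LinearMap.ker Bn ⊓ (LinearMap.range Bn1)ᗮ := by
  have h_orth : (LinearMap.range Bn1)ᗮ = LinearMap.ker (LinearMap.adjoint Bn1) := by
    ext x
    simp only [Submodule.mem_orthogonal, LinearMap.mem_range, forall_exists_index,
      forall_apply_eq_imp_iff, LinearMap.mem_ker, ← LinearMap.adjoint_inner_right]
    exact ⟨fun h => inner_self_eq_zero.mp (h _), fun h a => by rw [h, inner_zero_right]⟩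
  rw [h_orth]
  ext x
  simp only [LinearMap.mem_ker, Submodule.mem_inf, LinearMap.add_apply, LinearMap.comp_apply]
  refine ⟨fun h => ?_, fun ⟨h₁, h₂⟩ => by simp [h₁, h₂]⟩
  have h_energy : inner ℝ (Bn x) (Bn x) +
      inner ℝ (LinearMap.adjoint Bn1 x) (LinearMap.adjoint Bn1 x) = 0 := by
    rw [← LinearMap.adjoint_inner_right Bn, LinearMap.adjoint_inner_left Bn1,
      ← inner_add_right, h, inner_zero_right]
  rwa [add_eq_zero_iff_of_nonneg real_inner_self_nonneg real_inner_self_nonneg,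
    inner_self_eq_zero, inner_self_eq_zero] at h_energy
end

section
/- Let C_{n+1}, C_n, C_{n−1} be finite-dimensional real inner product spaces and let B_n : C_n → C_{n−1} and B_{n+1} : C_{n+1} → C_n be linear maps satisfying the chain condition B_n ∘ B_{n+1} = 0. Then the kernel of the combinatorial Laplacian L_n = B_n* ∘ B_n + B_{n+1} ∘ B_{n+1}* is linearly isomorphic to the quotient vector space ker(B_n) / range(B_{n+1}); in particular dim ker(L_n) = dim ker(B_n) − dim range(B_{n+1}). -/
/-- The kernel of the Laplacian `A* ∘ A + B ∘ B*` consists of the vectors of `ker A` orthogonal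
to `range B`. -/
theorem ker_adjoint_comp_add_comp_adjoint
    {E F G : Type*}
    [NormedAddCommGroup E] [InnerProductSpace ℝ E] [FiniteDimensional ℝ E]
    [NormedAddCommGroup F] [InnerProductSpace ℝ F] [FiniteDimensional ℝ F]
    [NormedAddCommGroup G] [InnerProductSpace ℝ G] [FiniteDimensional ℝ G]
    (A : F →ₗ[ℝ] G) (B : E →ₗ[ℝ] F) :
    LinearMap.ker (LinearMap.adjoint A ∘ₗ A + B ∘ₗ LinearMap.adjoint B) =
      LinearMap.ker A ⊓ (LinearMap.range B)ᗮ := by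
  rw [LinearMap.orthogonal_range]
  ext x
  simp only [Submodule.mem_inf, LinearMap.mem_ker, LinearMap.add_apply, LinearMap.comp_apply]
  refine ⟨fun h => ?_, fun ⟨hA, hB⟩ => by simp [hA, hB]⟩
  have hx : inner ℝ (A x) (A x) +
      inner ℝ (LinearMap.adjoint B x) (LinearMap.adjoint B x) = 0 := by
    rw [← LinearMap.adjoint_inner_left, LinearMap.adjoint_inner_right, ← inner_add_left, h,
      inner_zero_left]
  obtain ⟨hA, hB⟩ :=
    (add_eq_zero_iff_of_nonneg real_inner_self_nonneg real_inner_self_nonneg).mp hx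
  exact ⟨inner_self_eq_zero.mp hA, inner_self_eq_zero.mp hB⟩

theorem Submodule.map_subtype_orthogonal_comap_subtype
    {E : Type*} [NormedAddCommGroup E] [InnerProductSpace ℝ E]
    {K R : Submodule ℝ E} (h : R ≤ K) :
    (R.comap K.subtype)ᗮ.map K.subtype = K ⊓ Rᗮ := by
  ext x
  simp only [Submodule.mem_map, Submodule.mem_inf, Submodule.mem_orthogonal,
    Submodule.mem_comap, Submodule.subtype_apply]
  constructor
  · rintro ⟨y, hy, rfl⟩
    exact ⟨y.2, fun u hu => hy ⟨u, h hu⟩ hu⟩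
  · rintro ⟨hK, hR⟩
    exact ⟨⟨x, hK⟩, fun u hu => hR u hu, rfl⟩

/-- Discrete Hodge Theorem (Theorem 4.3): under the chain condition `Bₙ ∘ Bₙ₊₁ = 0`,
the kernel of the combinatorial Laplacian `Lₙ = Bₙ* ∘ Bₙ + Bₙ₊₁ ∘ Bₙ₊₁*` is linearly
isomorphic to the homology `ker Bₙ / range Bₙ₊₁`; in particular
`dim ker Lₙ = dim ker Bₙ − dim range Bₙ₊₁`. -/
theorem discrete_hodge_theorem
    {Cp Cn Cm : Type*}
    [NormedAddCommGroup Cp] [InnerProductSpace ℝ Cp] [FiniteDimensional ℝ Cp]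
    [NormedAddCommGroup Cn] [InnerProductSpace ℝ Cn] [FiniteDimensional ℝ Cn]
    [NormedAddCommGroup Cm] [InnerProductSpace ℝ Cm] [FiniteDimensional ℝ Cm]
    (Bn : Cn →ₗ[ℝ] Cm) (Bn1 : Cp →ₗ[ℝ] Cn)
    (hchain : Bn ∘ₗ Bn1 = 0) :
    Nonempty
      ((LinearMap.ker (LinearMap.adjoint Bn ∘ₗ Bn + Bn1 ∘ₗ LinearMap.adjoint Bn1)) ≃ₗ[ℝ]
        (LinearMap.ker Bn ⧸
          (LinearMap.range Bn1).comap (LinearMap.ker Bn).subtype)) ∧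
    Module.finrank ℝ
        (LinearMap.ker (LinearMap.adjoint Bn ∘ₗ Bn + Bn1 ∘ₗ LinearMap.adjoint Bn1)) =
      Module.finrank ℝ (LinearMap.ker Bn) -
        Module.finrank ℝ (LinearMap.range Bn1) := by
  have hle : LinearMap.range Bn1 ≤ LinearMap.ker Bn := LinearMap.range_le_ker_iff.mpr hchain
  set R := (LinearMap.range Bn1).comap (LinearMap.ker Bn).subtype
  have hker : LinearMap.ker (LinearMap.adjoint Bn ∘ₗ Bn + Bn1 ∘ₗ LinearMap.adjoint Bn1) =
      Rᗮ.map (LinearMap.ker Bn).subtype := by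
    rw [ker_adjoint_comp_add_comp_adjoint, Submodule.map_subtype_orthogonal_comap_subtype hle]
  let e := (LinearEquiv.ofEq _ _ hker).trans <|
    (Submodule.equivSubtypeMap (LinearMap.ker Bn) Rᗮ).symm.trans
      (Submodule.quotientEquivOfIsCompl R Rᗮ R.isCompl_orthogonal).symm
  refine ⟨⟨e⟩, ?_⟩
  rw [e.finrank_eq, Submodule.finrank_quotient,
    (Submodule.comapSubtypeEquivOfLe hle).finrank_eq]
end

section
/- Let C_{n+1}, C_n, C_{n−1} be finite-dimensional real inner product spaces, let B_n : C_n → C_{n−1} and B_{n+1} : C_{n+1} → C_n be linear maps satisfying B_n ∘ B_{n+1} = 0, and set L_n^down = B_n* ∘ B_n, L_n^up = B_{n+1} ∘ B_{n+1}*, L_n = L_n^down + L_n^up. Then for every real number λ ≠ 0, λ is an eigenvalue of L_n if and only if λ is an eigenvalue of L_n^down or λ is an eigenvalue of L_n^up. -/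
namespace Module.End

variable {K M : Type*} [Field K] [AddCommGroup M] [Module K M] {f g : End K M} {μ : K}

theorem HasEigenvalue.add_of_mul_eq_zero (hgf : g * f = 0) (hμ : μ ≠ 0)
    (hf : f.HasEigenvalue μ) : (f + g).HasEigenvalue μ := by
  obtain ⟨x, hx⟩ := hf.exists_hasEigenvector
  have hgx : g x = 0 := by
    have h : g (f x) = 0 := LinearMap.congr_fun hgf x
    rw [hx.apply_eq_smul, map_smul] at h
    exact (smul_eq_zero.mp h).resolve_left hμ
  refine hasEigenvalue_of_hasEigenvector (x := x) ⟨mem_eigenspace_iff.mpr ?_, hx.2⟩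
  rw [LinearMap.add_apply, hx.apply_eq_smul, hgx, add_zero]

/-- The nonzero eigenvalues of a sum of two endomorphisms annihilating each other are the
nonzero eigenvalues of the summands. -/
theorem hasEigenvalue_add_iff_of_mul_eq_zero (hfg : f * g = 0) (hgf : g * f = 0) (hμ : μ ≠ 0) :
    (f + g).HasEigenvalue μ ↔ f.HasEigenvalue μ ∨ g.HasEigenvalue μ := by
  refine ⟨fun h => ?_, ?_⟩
  · obtain ⟨x, hx⟩ := h.exists_hasEigenvector
    have hsum : f x + g x = μ • x := hx.apply_eq_smul
    have hfgx : f (g x) = 0 := LinearMap.congr_fun hfg x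
    by_cases hfx : f x = 0
    · have hgx : g x = μ • x := by rw [← hsum, hfx, zero_add]
      exact .inr (hasEigenvalue_of_hasEigenvector ⟨mem_eigenspace_iff.mpr hgx, hx.2⟩)
    · have hffx : f (f x) = μ • f x := by rw [← map_smul, ← hsum, map_add, hfgx, add_zero]
      exact .inl (hasEigenvalue_of_hasEigenvector ⟨mem_eigenspace_iff.mpr hffx, hfx⟩)
  · rintro (h | h)
    · exact h.add_of_mul_eq_zero hgf hμ
    · exact add_comm g f ▸ h.add_of_mul_eq_zero hfg hμ

end Module.End

/-- Spectral dichotomy: under the chain condition `Bₙ ∘ Bₙ₊₁ = 0`, every nonzero real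
`λ` is an eigenvalue of `Lₙ = Lₙ^down + Lₙ^up` iff it is an eigenvalue of `Lₙ^down` or
of `Lₙ^up`. -/
theorem eigenvalue_laplacian_iff
    {Cp Cn Cm : Type*}
    [NormedAddCommGroup Cp] [InnerProductSpace ℝ Cp] [FiniteDimensional ℝ Cp]
    [NormedAddCommGroup Cn] [InnerProductSpace ℝ Cn] [FiniteDimensional ℝ Cn]
    [NormedAddCommGroup Cm] [InnerProductSpace ℝ Cm] [FiniteDimensional ℝ Cm]
    (Bn : Cn →ₗ[ℝ] Cm) (Bn1 : Cp →ₗ[ℝ] Cn)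
    (hchain : Bn ∘ₗ Bn1 = 0)
    (lam : ℝ) (hlam : lam ≠ 0) :
    Module.End.HasEigenvalue
        (LinearMap.adjoint Bn ∘ₗ Bn + Bn1 ∘ₗ LinearMap.adjoint Bn1 : Module.End ℝ Cn) lam ↔
      Module.End.HasEigenvalue (LinearMap.adjoint Bn ∘ₗ Bn : Module.End ℝ Cn) lam ∨
        Module.End.HasEigenvalue (Bn1 ∘ₗ LinearMap.adjoint Bn1 : Module.End ℝ Cn) lam := by
  have hadj : LinearMap.adjoint Bn1 ∘ₗ LinearMap.adjoint Bn = 0 := by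
    rw [← LinearMap.adjoint_comp, hchain, map_zero]
  refine Module.End.hasEigenvalue_add_iff_of_mul_eq_zero ?_ ?_ hlam
  · rw [Module.End.mul_eq_comp, LinearMap.comp_assoc, ← LinearMap.comp_assoc _ Bn1 Bn, hchain,
      LinearMap.zero_comp, LinearMap.comp_zero]
  · rw [Module.End.mul_eq_comp, LinearMap.comp_assoc, ← LinearMap.comp_assoc Bn, hadj,
      LinearMap.zero_comp, LinearMap.comp_zero]
end

section
/- Let n be a natural number and let B_n ∈ ℝ^{p×q} and B_{n+1} ∈ ℝ^{q×r} be matrices with all entries in {−1, 0, 1} such that B_n · B_{n+1} = 0, each column of B_n has at most n + 1 nonzero entries, and each column of B_{n+1} has at most n + 2 nonzero entries. Let u ∈ ℝ^p, w ∈ ℝ^q, x ∈ ℝ^r be strictly positive vectors satisfying the filtration condition: w_c ≤ u_b whenever (B_n)_{bc} ≠ 0 and x_f ≤ w_c whenever (B_{n+1})_{cf} ≠ 0. With W_{n−1}, W_n, W_{n+1} the diagonal matrices of u, w, x, define B̃_n = W_{n−1}^{−1} B_n W_n, B̃_{n+1} = W_n^{−1} B_{n+1} W_{n+1}, and L̃_n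 = B̃_nᵀ B̃_n + B̃_{n+1} B̃_{n+1}ᵀ. Then the spectral (operator 2-)norm of L̃_n satisfies ‖L̃_n‖ ≤ (n + 2) · max(q, r); in particular this bound is independent of the choice of weights. -/
open Matrix

open scoped InnerProductSpace in
/-- The norm of a sum of two self-adjoint operators with zero product is bounded by any common
bound of their norms. -/
lemma ContinuousLinearMap.opNorm_add_le_of_mul_eq_zero {𝕜 E : Type*} [RCLike 𝕜]
    [NormedAddCommGroup E] [InnerProductSpace 𝕜 E] [CompleteSpace E] {S T : E →L[𝕜] E}
    (hS : IsSelfAdjoint S) (hT : IsSelfAdjoint T) (hST : S * T = 0) {M : ℝ}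
    (hSM : ‖S‖ ≤ M) (hTM : ‖T‖ ≤ M) : ‖S + T‖ ≤ M := by
  have hM : 0 ≤ M := (norm_nonneg S).trans hSM
  have hTS : T * S = 0 := by simpa [hS.star_eq, hT.star_eq] using congrArg star hST
  have hST' (v : E) : S (T v) = 0 := DFunLike.congr_fun hST v
  have hTS' (v : E) : T (S v) = 0 := DFunLike.congr_fun hTS v
  have hort (v w : E) : ⟪S v, T w⟫_𝕜 = 0 :=
    (hS.isSymmetric v (T w)).trans (by simp [hST'])
  have hnorm (v w : E) : ‖S v + T w‖ ^ 2 = ‖S v‖ ^ 2 + ‖T w‖ ^ 2 := by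
    simpa only [sq] using norm_add_sq_eq_norm_sq_add_norm_sq_of_inner_eq_zero _ _ (hort v w)
  refine opNorm_le_bound _ hM fun v => ?_
  set y := (S + T) v with hy
  have hLy : ‖(S + T) y‖ ≤ M * ‖y‖ := by
    have h1 : (S + T) y = S (S v) + T (T v) := by simp [hy, hST', hTS']
    refine le_of_sq_le_sq ?_ (by positivity)
    calc ‖(S + T) y‖ ^ 2 = ‖S (S v)‖ ^ 2 + ‖T (T v)‖ ^ 2 := by rw [h1, hnorm]
      _ ≤ (M * ‖S v‖) ^ 2 + (M * ‖T v‖) ^ 2 := by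
        gcongr
        · exact S.le_of_opNorm_le hSM _
        · exact T.le_of_opNorm_le hTM _
      _ = (M * ‖y‖) ^ 2 := by
        rw [hy, _root_.add_apply, mul_pow, mul_pow, mul_pow, hnorm, mul_add]
  have hyy : ‖y‖ * ‖y‖ ≤ M * ‖v‖ * ‖y‖ := by
    calc ‖y‖ * ‖y‖ = ‖⟪y, (S + T) v⟫_𝕜‖ := by
          rw [← hy, inner_self_eq_norm_sq_to_K]; simp [sq]
      _ = ‖⟪(S + T) y, v⟫_𝕜‖ := congrArg _ ((hS.add hT).isSymmetric y v).symm
      _ ≤ ‖(S + T) y‖ * ‖v‖ := norm_inner_le_norm _ _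
      _ ≤ M * ‖y‖ * ‖v‖ := by gcongr
      _ = M * ‖v‖ * ‖y‖ := by ring
  rcases (norm_nonneg y).eq_or_lt with h0 | h0
  · rw [← h0]; positivity
  · exact le_of_mul_le_mul_right hyy h0

open scoped Matrix.Norms.L2Operator in
/-- The spectral norm is bounded by the Frobenius norm. -/
lemma Matrix.l2_opNorm_sq_le_sum_sq {m n : Type*} [Fintype m] [Fintype n] [DecidableEq n]
    (A : Matrix m n ℝ) : ‖A‖ ^ 2 ≤ ∑ i, ∑ j, A i j ^ 2 := by
  have h0 : 0 ≤ ∑ i, ∑ j, A i j ^ 2 := by positivity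
  suffices h : ‖A‖ ≤ √(∑ i, ∑ j, A i j ^ 2) by
    simpa [Real.sq_sqrt h0] using pow_le_pow_left₀ (norm_nonneg A) h 2
  rw [l2_opNorm_def]
  refine ContinuousLinearMap.opNorm_le_bound _ (Real.sqrt_nonneg _) fun v => ?_
  refine le_of_sq_le_sq ?_ (by positivity)
  rw [mul_pow, Real.sq_sqrt h0, EuclideanSpace.norm_sq_eq, EuclideanSpace.norm_sq_eq,
    Finset.sum_mul]
  refine Finset.sum_le_sum fun i _ => ?_
  simpa [mulVec, dotProduct] using
    Finset.sum_mul_sq_le_sq_mul_sq Finset.univ (A i) v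

open scoped Matrix.Norms.L2Operator in
/-- A matrix with entries in `[-1, 1]` and at most `k` nonzero entries in each column has squared
spectral norm at most `k` times the number of columns. -/
lemma Matrix.l2_opNorm_sq_le_of_col_card_le {m n : Type*} [Fintype m] [Fintype n] [DecidableEq n]
    {A : Matrix m n ℝ} {k : ℕ} (hA : ∀ i j, |A i j| ≤ 1)
    (hcol : ∀ j, (Finset.univ.filter fun i => A i j ≠ 0).card ≤ k) :
    ‖A‖ ^ 2 ≤ k * Fintype.card n := by
  have hj (j : n) : ∑ i, A i j ^ 2 ≤ k := by
    calc ∑ i, A i j ^ 2 ≤ ∑ i, if A i j ≠ 0 then (1 : ℝ) else 0 := by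
          refine Finset.sum_le_sum fun i _ => ?_
          split_ifs with h
          · exact (sq_le_one_iff_abs_le_one _).2 (hA i j)
          · simp_all
      _ = (Finset.univ.filter fun i => A i j ≠ 0).card := Finset.sum_boole _ _
      _ ≤ k := mod_cast hcol j
  calc ‖A‖ ^ 2 ≤ ∑ j, ∑ i, A i j ^ 2 := A.l2_opNorm_sq_le_sum_sq.trans_eq Finset.sum_comm
    _ ≤ ∑ _j : n, (k : ℝ) := Finset.sum_le_sum fun j _ => hj j
    _ = k * Fintype.card n := by simp [mul_comm]

open scoped Matrix.Norms.L2Operator in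
/-- If `A * C = 0`, then `‖AᵀA + CCᵀ‖` is bounded by any common bound of `‖A‖²` and `‖C‖²`. -/
lemma Matrix.opNorm_transpose_mul_self_add_le {l m n : Type*} [Fintype l] [Fintype m] [Fintype n]
    [DecidableEq m] [DecidableEq n] {A : Matrix l m ℝ} {C : Matrix m n ℝ}
    (hAC : A * C = 0) {M : ℝ} (hA : ‖A‖ ^ 2 ≤ M) (hC : ‖C‖ ^ 2 ≤ M) :
    ‖toEuclideanCLM (𝕜 := ℝ) (Aᵀ * A + C * Cᵀ)‖ ≤ M := by
  rw [map_add]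
  refine ContinuousLinearMap.opNorm_add_le_of_mul_eq_zero ?_ ?_ ?_ ?_ ?_
  · exact IsSelfAdjoint.map (isHermitian_conjTranspose_mul_self A) _
  · exact IsSelfAdjoint.map (isHermitian_mul_conjTranspose_self C) _
  · rw [← map_mul, Matrix.mul_assoc, ← Matrix.mul_assoc A, hAC, Matrix.zero_mul, Matrix.mul_zero,
      map_zero]
  · rw [l2_opNorm_toEuclideanCLM]
    exact (l2_opNorm_conjTranspose_mul_self A).trans_le (by rwa [← sq])
  · rw [l2_opNorm_toEuclideanCLM]
    have h := l2_opNorm_conjTranspose_mul_self Cᴴ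
    rw [conjTranspose_conjTranspose, l2_opNorm_conjTranspose, ← sq] at h
    exact h.trans_le hC

lemma Matrix.inv_diagonal_mul_mul_diagonal_apply {m n : Type*} [Fintype m] [Fintype n]
    [DecidableEq m] [DecidableEq n] {a : m → ℝ} (ha : ∀ i, 0 < a i) (B : Matrix m n ℝ) (b : n → ℝ)
    (i : m) (j : n) : ((diagonal a)⁻¹ * B * diagonal b) i j = (a i)⁻¹ * B i j * b j := by
  have hinv : (diagonal a)⁻¹ = diagonal fun i => (a i)⁻¹ :=
    inv_eq_right_inv (by simp [diagonal_mul_diagonal, (ha _).ne'])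
  rw [hinv, mul_diagonal, diagonal_mul]

open scoped Matrix.Norms.L2Operator in
/-- Rescaling a matrix with entries in `{-1, 0, 1}` by weights satisfying the filtration condition
keeps the column bound on the spectral norm. -/
lemma Matrix.l2_opNorm_sq_inv_diagonal_mul_mul_diagonal_le {m n : Type*} [Fintype m] [Fintype n]
    [DecidableEq m] [DecidableEq n] {B : Matrix m n ℝ} {k : ℕ}
    (hB : ∀ i j, B i j = -1 ∨ B i j = 0 ∨ B i j = 1)
    (hcol : ∀ j, (Finset.univ.filter fun i => B i j ≠ 0).card ≤ k)
    {a : m → ℝ} {b : n → ℝ} (ha : ∀ i, 0 < a i) (hb : ∀ j, 0 < b j)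
    (hab : ∀ i j, B i j ≠ 0 → b j ≤ a i) :
    ‖(diagonal a)⁻¹ * B * diagonal b‖ ^ 2 ≤ k * Fintype.card n := by
  refine l2_opNorm_sq_le_of_col_card_le (fun i j => ?_) fun j => ?_
  · rw [inv_diagonal_mul_mul_diagonal_apply ha]
    by_cases h : B i j = 0
    · simp [h]
    · have hone : |B i j| = 1 := by rcases hB i j with h' | h' | h' <;> simp_all
      rw [abs_mul, abs_mul, hone, mul_one, abs_of_pos (inv_pos.2 (ha i)), abs_of_pos (hb j)]
      exact inv_mul_le_one_of_le₀ (hab i j h) (ha i).le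
  · refine (Finset.card_le_card fun i => ?_).trans (hcol j)
    simp only [Finset.mem_filter_univ, inv_diagonal_mul_mul_diagonal_apply ha]
    exact fun h h0 => h (by simp [h0])

/-- Proposition 5.3: under the filtration condition, the spectral norm of the weighted
combinatorial Laplacian `L̃ₙ = B̃ₙᵀ B̃ₙ + B̃ₙ₊₁ B̃ₙ₊₁ᵀ`, with
`B̃ₙ = Wₙ₋₁⁻¹ Bₙ Wₙ` and `B̃ₙ₊₁ = Wₙ⁻¹ Bₙ₊₁ Wₙ₊₁`, is at most `(n + 2) · max q r`,
a bound independent of the choice of weights. -/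
theorem opNorm_weighted_laplacian_le
    (n p q r : ℕ)
    (Bn : Matrix (Fin p) (Fin q) ℝ) (Bn1 : Matrix (Fin q) (Fin r) ℝ)
    (hBn : ∀ i j, Bn i j = -1 ∨ Bn i j = 0 ∨ Bn i j = 1)
    (hBn1 : ∀ i j, Bn1 i j = -1 ∨ Bn1 i j = 0 ∨ Bn1 i j = 1)
    (hchain : Bn * Bn1 = 0)
    (hcoln : ∀ j, (Finset.univ.filter fun i => Bn i j ≠ 0).card ≤ n + 1)
    (hcoln1 : ∀ j, (Finset.univ.filter fun i => Bn1 i j ≠ 0).card ≤ n + 2)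
    (u : Fin p → ℝ) (w : Fin q → ℝ) (x : Fin r → ℝ)
    (hu : ∀ i, 0 < u i) (hw : ∀ i, 0 < w i) (hx : ∀ i, 0 < x i)
    (hf1 : ∀ b c, Bn b c ≠ 0 → w c ≤ u b)
    (hf2 : ∀ c f, Bn1 c f ≠ 0 → x f ≤ w c) :
    ‖Matrix.toEuclideanCLM (𝕜 := ℝ)
        ((((Matrix.diagonal u)⁻¹ * Bn * Matrix.diagonal w)ᵀ *
            ((Matrix.diagonal u)⁻¹ * Bn * Matrix.diagonal w)) +
          (((Matrix.diagonal w)⁻¹ * Bn1 * Matrix.diagonal x) *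
            ((Matrix.diagonal w)⁻¹ * Bn1 * Matrix.diagonal x)ᵀ))‖ ≤
      ((n : ℝ) + 2) * max (q : ℝ) (r : ℝ) := by
  have hw' : diagonal w * (diagonal w)⁻¹ = 1 :=
    mul_nonsing_inv _ (by simp [det_diagonal, Finset.prod_ne_zero_iff, (hw _).ne'])
  refine opNorm_transpose_mul_self_add_le ?_ ?_ ?_
  · calc (diagonal u)⁻¹ * Bn * diagonal w * ((diagonal w)⁻¹ * Bn1 * diagonal x)
        = (diagonal u)⁻¹ * Bn * (diagonal w * (diagonal w)⁻¹) * Bn1 * diagonal x := by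
          simp only [Matrix.mul_assoc]
      _ = (diagonal u)⁻¹ * (Bn * Bn1) * diagonal x := by
          rw [hw', Matrix.mul_one, Matrix.mul_assoc _ Bn]
      _ = 0 := by rw [hchain, Matrix.mul_zero, Matrix.zero_mul]
  · refine (l2_opNorm_sq_inv_diagonal_mul_mul_diagonal_le hBn hcoln hu hw
      fun i j => hf1 i j).trans ?_
    rw [Fintype.card_fin]
    gcongr
    · push_cast; linarith
    · exact le_max_left _ _
  · refine (l2_opNorm_sq_inv_diagonal_mul_mul_diagonal_le hBn1 hcoln1 hw hx
      fun i j => hf2 i j).trans ?_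
    rw [Fintype.card_fin]
    gcongr
    · push_cast; rfl
    · exact le_max_right _ _
end

section
/- Let B ∈ ℝ^{m×p} be a matrix with all entries in {−1, 0, 1}, let k be a natural number, and let F be a set of columns of B such that each column in F has at most k nonzero entries and the supports of distinct columns in F are pairwise disjoint. Let v ∈ ℝ^m be a vector such that for every row i in the support of v, every column of B having a nonzero entry in row i belongs to F. Then ‖B Bᵀ v‖ ≤ k ‖v‖ in the Euclidean norm. -/
open Matrix

/-- Cauchy–Schwarz for a sum with coefficients in `{-1, 0, 1}`, keeping the support of the
coefficients on the right-hand side. -/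
theorem sq_sum_sign_mul_le {ι : Type*} (s : Finset ι) (b x : ι → ℝ) {c : ℝ}
    (hb : ∀ i, b i = -1 ∨ b i = 0 ∨ b i = 1) (hc : ∑ i ∈ s, b i ^ 2 ≤ c) :
    (∑ i ∈ s, b i * x i) ^ 2 ≤ c * ∑ i ∈ s, b i ^ 2 * x i ^ 2 := by
  have h₁ : ∑ i ∈ s, b i * x i = ∑ i ∈ s, b i * (b i ^ 2 * x i) :=
    Finset.sum_congr rfl fun i _ => by rcases hb i with h | h | h <;> simp [h]
  have h₂ : ∑ i ∈ s, b i ^ 2 * x i ^ 2 = ∑ i ∈ s, (b i ^ 2 * x i) ^ 2 :=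
    Finset.sum_congr rfl fun i _ => by rcases hb i with h | h | h <;> simp [h]
  rw [h₁, h₂]
  exact (Finset.sum_mul_sq_le_sq_mul_sq s _ _).trans
    (mul_le_mul_of_nonneg_right hc (Finset.sum_nonneg fun i _ => sq_nonneg _))

/-- The squares of sign coefficients sum to the size of their support. -/
theorem sum_sq_sign_eq_card {ι : Type*} (s : Finset ι) (b : ι → ℝ)
    (hb : ∀ i, b i = -1 ∨ b i = 0 ∨ b i = 1) :
    ∑ i ∈ s, b i ^ 2 = ((s.filter fun i => b i ≠ 0).card : ℝ) := by
  rw [Finset.card_filter, Nat.cast_sum]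
  exact Finset.sum_congr rfl fun i _ => by rcases hb i with h | h | h <;> simp [h]

/-- Lemma A.2 ('inequality about a union'), matrix form: let `B` be a sign matrix,
`F` a set of columns each with at most `k` nonzero entries and with pairwise disjoint
supports, and `v` a vector such that every column of `B` meeting the support of `v`
belongs to `F`. Then `‖B Bᵀ v‖ ≤ k ‖v‖` in the Euclidean norm. -/
theorem up_laplacian_on_boundary_le
    (m p k : ℕ) (B : Matrix (Fin m) (Fin p) ℝ)
    (hB : ∀ i j, B i j = -1 ∨ B i j = 0 ∨ B i j = 1)
    (F : Finset (Fin p))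
    (hcard : ∀ j ∈ F, (Finset.univ.filter fun i => B i j ≠ 0).card ≤ k)
    (hdisj : ∀ j₁ ∈ F, ∀ j₂ ∈ F, j₁ ≠ j₂ → ∀ i, B i j₁ = 0 ∨ B i j₂ = 0)
    (v : EuclideanSpace ℝ (Fin m))
    (hsupp : ∀ i, v i ≠ 0 → ∀ j, B i j ≠ 0 → j ∈ F) :
    ‖Matrix.toEuclideanLin (B * Bᵀ) v‖ ≤ (k : ℝ) * ‖v‖ := by
  have hcol : ∀ j ∈ F, ∑ i, B i j ^ 2 ≤ (k : ℝ) := fun j hj => by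
    rw [sum_sq_sign_eq_card _ _ fun i => hB i j]
    exact_mod_cast hcard j hj
  have hrow : ∀ i, ∑ j ∈ F, B i j ^ 2 ≤ (1 : ℝ) := fun i => by
    rw [sum_sq_sign_eq_card _ _ (hB i)]
    have : (F.filter fun j => B i j ≠ 0).card ≤ 1 := by
      refine Finset.card_le_one.2 fun a ha b hb => ?_
      rw [Finset.mem_filter] at ha hb
      by_contra hab
      exact (hdisj a ha.1 b hb.1 hab i).elim ha.2 hb.2
    exact_mod_cast this
  let w : Fin p → ℝ := fun j => ∑ i, B i j * v i
  have hw : ∀ j ∉ F, w j = 0 := fun j hj => Finset.sum_eq_zero fun i _ => by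
    by_contra h
    exact hj (hsupp i (right_ne_zero_of_mul h) j (left_ne_zero_of_mul h))
  have hval : ∀ i, Matrix.toEuclideanLin (B * Bᵀ) v i = ∑ j ∈ F, B i j * w j := fun i => by
    have h : Matrix.toEuclideanLin (B * Bᵀ) v i = ∑ j, B i j * w j := by
      change ((B * Bᵀ) *ᵥ v.ofLp) i = _
      rw [← Matrix.mulVec_mulVec]
      rfl
    rw [h]
    exact (Finset.sum_subset (Finset.subset_univ F) fun j _ hj => by simp [hw j hj]).symm
  have hk : (0 : ℝ) ≤ k := k.cast_nonneg
  have hwv : ∑ j ∈ F, w j ^ 2 ≤ k * ∑ i, v i ^ 2 := calc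
    ∑ j ∈ F, w j ^ 2 ≤ ∑ j ∈ F, k * ∑ i, B i j ^ 2 * v i ^ 2 :=
      Finset.sum_le_sum fun j hj => sq_sum_sign_mul_le _ _ _ (fun i => hB i j) (hcol j hj)
    _ = k * ∑ i, (∑ j ∈ F, B i j ^ 2) * v i ^ 2 := by
      rw [← Finset.mul_sum, Finset.sum_comm]
      simp only [Finset.sum_mul]
    _ ≤ k * ∑ i, v i ^ 2 := mul_le_mul_of_nonneg_left
      (Finset.sum_le_sum fun i _ => mul_le_of_le_one_left (sq_nonneg _) (hrow i)) hk
  refine abs_le_of_sq_le_sq' ?_ (mul_nonneg hk (norm_nonneg v)) |>.2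
  rw [mul_pow, EuclideanSpace.real_norm_sq_eq, EuclideanSpace.real_norm_sq_eq]
  calc
    ∑ i, Matrix.toEuclideanLin (B * Bᵀ) v i ^ 2
      ≤ ∑ i, ∑ j ∈ F, B i j ^ 2 * w j ^ 2 := Finset.sum_le_sum fun i _ => by
        rw [hval i]
        simpa using sq_sum_sign_mul_le F (B i) w (hB i) (hrow i)
    _ = ∑ j ∈ F, (∑ i, B i j ^ 2) * w j ^ 2 := by
      rw [Finset.sum_comm]
      simp only [Finset.sum_mul]
    _ ≤ ∑ j ∈ F, k * w j ^ 2 :=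
      Finset.sum_le_sum fun j hj => mul_le_mul_of_nonneg_right (hcol j hj) (sq_nonneg _)
    _ = k * ∑ j ∈ F, w j ^ 2 := by rw [Finset.mul_sum]
    _ ≤ k * (k * ∑ i, v i ^ 2) := mul_le_mul_of_nonneg_left hwv hk
    _ = k ^ 2 * ∑ i, v i ^ 2 := by ring
end
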